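/- Let c be a real number and let D, G, H be subsets of [0,∞) having least elements λ = min D, γ = min G, μ = min H, and assume λ > 1 − c². Define I¹ = {√((c−1)² + a) : a ∈ G} ∪ {−√((c−1)² + a) : a ∈ G}, I² = {√((c+1)² + a) : a ∈ H} ∪ {−√((c+1)² + a) : a ∈ H}, I³ = {√(c² + a) − 1 : a ∈ D} ∪ {−(√(c² + a) − 1) : a ∈ D}, and I⁴ = {√(c² + a) + 1 : a ∈ D} ∪ {−(√(c² + a) + 1) : a ∈ D}. Then the set (I¹ ∪ I² ∪ I³ ∪ I⁴) ∩ [0, ∞) has a least element, equal to min( √(c² + λ) − 1, √((c−1)² + γ), √((c+1)² + μ) ). -/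

import Mathlib

/-- If `f` is monotone and nonnegative at the least element `m` of `S`, then `f m` is the least
nonnegative element of the symmetric set `f '' S ∪ -f '' S`. -/
theorem IsLeast.image_union_neg_inter_Ici {f : ℝ → ℝ} (hf : Monotone f) {S : Set ℝ} {m : ℝ}
    (hm : IsLeast S m) (h₀ : 0 ≤ f m) :
    IsLeast ((f '' S ∪ (fun a => -f a) '' S) ∩ Set.Ici 0) (f m) := by
  refine ⟨⟨Or.inl ⟨m, hm.1, rfl⟩, h₀⟩, ?_⟩
  rintro _ ⟨⟨a, ha, rfl⟩ | ⟨a, ha, rfl⟩, hx⟩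
  · exact hf (hm.2 ha)
  · have hma : f m ≤ f a := hf (hm.2 ha)
    have hx' : 0 ≤ -f a := hx
    change f m ≤ -f a
    linarith

theorem monotone_sqrt_const_add (k : ℝ) : Monotone fun a : ℝ => Real.sqrt (k + a) :=
  fun _ _ h => Real.sqrt_le_sqrt (by gcongr)

/-- Let `c` be real and `D, G, H ⊆ [0,∞)` with least elements `lam, gam, mu`,
and assume `lam > 1 − c²`.  With the indicial root families
`I¹ = ±√((c−1)² + a), a ∈ G`, `I² = ±√((c+1)² + a), a ∈ H`,
`I³ = ±(√(c² + a) − 1), a ∈ D`, `I⁴ = ±(√(c² + a) + 1), a ∈ D`,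
the set `(I¹ ∪ I² ∪ I³ ∪ I⁴) ∩ [0,∞)` has least element
`min(√(c² + lam) − 1, √((c−1)² + gam), √((c+1)² + mu))`. -/
theorem smallest_nonneg_indicial_root (c lam gam mu : ℝ) (D G H : Set ℝ)
    (hD : D ⊆ Set.Ici 0) (hG : G ⊆ Set.Ici 0) (hH : H ⊆ Set.Ici 0)
    (hlam : IsLeast D lam) (hgam : IsLeast G gam) (hmu : IsLeast H mu)
    (hcond : lam > 1 - c ^ 2) :
    IsLeast
      ((((fun a : ℝ => Real.sqrt ((c - 1) ^ 2 + a)) '' G ∪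
            (fun a : ℝ => -Real.sqrt ((c - 1) ^ 2 + a)) '' G) ∪
          ((fun a : ℝ => Real.sqrt ((c + 1) ^ 2 + a)) '' H ∪
            (fun a : ℝ => -Real.sqrt ((c + 1) ^ 2 + a)) '' H) ∪
          ((fun a : ℝ => Real.sqrt (c ^ 2 + a) - 1) '' D ∪
            (fun a : ℝ => -(Real.sqrt (c ^ 2 + a) - 1)) '' D) ∪
          ((fun a : ℝ => Real.sqrt (c ^ 2 + a) + 1) '' D ∪
            (fun a : ℝ => -(Real.sqrt (c ^ 2 + a) + 1)) '' D)) ∩ Set.Ici 0)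
      (min (Real.sqrt (c ^ 2 + lam) - 1)
        (min (Real.sqrt ((c - 1) ^ 2 + gam)) (Real.sqrt ((c + 1) ^ 2 + mu)))) := by
  have hd : 1 < Real.sqrt (c ^ 2 + lam) := Real.lt_sqrt_of_sq_lt (by linarith)
  have h₁ := hgam.image_union_neg_inter_Ici (monotone_sqrt_const_add ((c - 1) ^ 2))
    (Real.sqrt_nonneg _)
  have h₂ := hmu.image_union_neg_inter_Ici (monotone_sqrt_const_add ((c + 1) ^ 2))
    (Real.sqrt_nonneg _)
  have h₃ := hlam.image_union_neg_inter_Ici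
    (f := fun a => Real.sqrt (c ^ 2 + a) - 1)
    (fun _ _ h => sub_le_sub_right (monotone_sqrt_const_add (c ^ 2) h) 1) (by linarith)
  have h₄ := hlam.image_union_neg_inter_Ici
    (f := fun a => Real.sqrt (c ^ 2 + a) + 1)
    (fun _ _ h => add_le_add_left (monotone_sqrt_const_add (c ^ 2) h) 1) (by linarith)
  have h := ((h₁.union h₂).union h₃).union h₄
  simp only [← Set.union_inter_distrib_right] at h
  rwa [min_assoc (min _ _),
    min_eq_left (by linarith : Real.sqrt (c ^ 2 + lam) - 1 ≤ Real.sqrt (c ^ 2 + lam) + 1),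
    min_comm] at h
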